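/- Let r be an odd prime and n a natural number with n ≥ r^2. Then every Sylow r-subgroup of the alternating group A_n is non-abelian (not commutative). -/

import Mathlib

/-- If a Sylow `p`-subgroup is commutative, then so is every `p`-group embedding in the group. -/
theorem Sylow.isMulCommutative_of_injective {p : ℕ} [Fact p.Prime] {G H : Type*} [Group G]
    [Finite G] [Group H] (P : Sylow p G) [IsMulCommutative (P : Subgroup G)]
    (hH : IsPGroup p H) {f : H →* G} (hf : Function.Injective f) : IsMulCommutative H := by
  obtain ⟨Q, hQ⟩ := (hH.of_surjective f.rangeRestrict f.rangeRestrict_surjective).exists_le_sylow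
  rw [isMulCommutative_iff]
  intro a b
  let e := Q.equiv P
  have hab := mul_comm' (e ⟨f a, hQ ⟨a, rfl⟩⟩) (e ⟨f b, hQ ⟨b, rfl⟩⟩)
  rw [← map_mul, ← map_mul] at hab
  apply hf
  simpa using congrArg Subtype.val (e.injective hab)

theorem RegularWreathProduct.not_isMulCommutative (D Q : Type*) [Group D] [Group Q] [Nontrivial D]
    [Nontrivial Q] : ¬ IsMulCommutative (D ≀ᵣ Q) := by
  classical
  intro h
  obtain ⟨d, hd⟩ := exists_ne (1 : D)
  obtain ⟨q, hq⟩ := exists_ne (1 : Q)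
  have hcomm := mul_comm' (⟨Pi.mulSingle 1 d, 1⟩ : D ≀ᵣ Q) (inl q)
  have hleft := congrFun (congrArg RegularWreathProduct.left hcomm) 1
  simp [Pi.mulSingle_eq_of_ne (inv_ne_one.mpr hq), hd] at hleft

/-- A group of odd order acts by even permutations. -/
theorem Equiv.Perm.map_mem_alternatingGroup_of_odd_card {G α : Type*} [Group G] [Fintype α]
    [DecidableEq α] (hG : Odd (Nat.card G)) (f : G →* Equiv.Perm α) (g : G) :
    f g ∈ alternatingGroup α := by
  have hpow : sign (f g) ^ Nat.card G = 1 := by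
    rw [← map_pow, ← map_pow, pow_card_eq_one', map_one, map_one]
  rwa [Int.units_pow_eq_pow_mod_two, Nat.odd_iff.mp hG, pow_one] at hpow

/-- Let `r` be an odd prime and `n ≥ r ^ 2`. Every Sylow `r`-subgroup of the alternating
group `A_n` is non-abelian. -/
theorem alternatingGroup_sylow_not_isCommutative (r n : ℕ) (hr : r.Prime) (hodd : Odd r)
    (hn : r ^ 2 ≤ n) (P : Sylow r (alternatingGroup (Fin n))) :
    ¬ IsMulCommutative (P : Subgroup (alternatingGroup (Fin n))) := by
  intro hP
  have : Fact r.Prime := ⟨hr⟩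
  let C := Multiplicative (ZMod r)
  have hC : Nat.card C = r := Nat.card_zmod r
  have hW : Nat.card (C ≀ᵣ C) = r ^ (r + 1) := by
    rw [RegularWreathProduct.card, hC, pow_succ]
  obtain ⟨ι⟩ : Nonempty (C × C ↪ Fin n) := by
    rw [Function.Embedding.nonempty_iff_card_le, ← Nat.card_eq_fintype_card, Nat.card_prod, hC,
      Fintype.card_fin, ← sq]
    exact hn
  let f : C ≀ᵣ C →* Equiv.Perm (Fin n) :=
    (Equiv.Perm.viaEmbeddingHom ι).comp (RegularWreathProduct.toPerm C C C)
  have hf : Function.Injective f :=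
    (Equiv.Perm.viaEmbeddingHom_injective ι).comp (RegularWreathProduct.toPermInj C C C)
  have hmem := Equiv.Perm.map_mem_alternatingGroup_of_odd_card (hW ▸ hodd.pow) f
  exact RegularWreathProduct.not_isMulCommutative C C <|
    P.isMulCommutative_of_injective (IsPGroup.of_card hW)
      (f := f.codRestrict (alternatingGroup (Fin n)) hmem)
      ((MonoidHom.injective_codRestrict f _ hmem).mpr hf)
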